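/- Let n ≥ 1 and let t ∈ ℝ³_H be such that sin(π(t₁−t₂)/3), sin(π(t₂−t₃)/3) and sin(π(t₃−t₁)/3) are all nonzero. Then the Dirichlet-type kernel D_n(t) = Σ_{j ∈ ℍ_n*} φ_j(t) satisfies D_n(t) = Θ_n(t) − Θ_{n−1}(t). -/

import Mathlib

open MeasureTheory
open scoped Real Classical

noncomputable section

/-- `φ_j(t) = exp(2πi (j₁t₁ + j₂t₂ + j₃t₃)/3)` for `j ∈ ℤ³`, `t ∈ ℝ³`. -/
def phi (j : ℤ × ℤ × ℤ) (t : ℝ × ℝ × ℝ) : ℂ :=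
  Complex.exp (2 * (Real.pi : ℂ) * Complex.I *
    ((j.1 : ℂ) * (t.1 : ℂ) + (j.2.1 : ℂ) * (t.2.1 : ℂ) + (j.2.2 : ℂ) * (t.2.2 : ℂ)) / 3)

/-- `ℍ_n = {j ∈ ℍ : -n ≤ j₁ < n, -n ≤ j₂ < n, -n ≤ -j₃ < n}`. -/
def Hn (n : ℕ) : Set (ℤ × ℤ × ℤ) :=
  {j | j.1 + j.2.1 + j.2.2 = 0 ∧ -(n : ℤ) ≤ j.1 ∧ j.1 < n ∧
       -(n : ℤ) ≤ j.2.1 ∧ j.2.1 < n ∧ -(n : ℤ) ≤ -j.2.2 ∧ -j.2.2 < n}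

/-- `ℍ_n* = {j ∈ ℍ : -n ≤ j₁, j₂, j₃ ≤ n}`. -/
def Hstar (n : ℕ) : Set (ℤ × ℤ × ℤ) :=
  {j | j.1 + j.2.1 + j.2.2 = 0 ∧ -(n : ℤ) ≤ j.1 ∧ j.1 ≤ n ∧
       -(n : ℤ) ≤ j.2.1 ∧ j.2.1 ≤ n ∧ -(n : ℤ) ≤ j.2.2 ∧ j.2.2 ≤ n}

/-- `ℍ_n° = {j ∈ ℍ : -n < j₁, j₂, j₃ < n}`. -/
def Hcirc (n : ℕ) : Set (ℤ × ℤ × ℤ) :=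
  {j | j.1 + j.2.1 + j.2.2 = 0 ∧ -(n : ℤ) < j.1 ∧ j.1 < n ∧
       -(n : ℤ) < j.2.1 ∧ j.2.1 < n ∧ -(n : ℤ) < j.2.2 ∧ j.2.2 < n}

/-- The weights `c_j^{(n)}`: 1 on interior points, 1/2 on edge points, 1/3 on vertices. -/
def cwt (n : ℕ) (j : ℤ × ℤ × ℤ) : ℝ :=
  if -(n : ℤ) < j.1 ∧ j.1 < n ∧ -(n : ℤ) < j.2.1 ∧ j.2.1 < n ∧
      -(n : ℤ) < j.2.2 ∧ j.2.2 < n then 1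
  else if j.1 * j.2.1 * j.2.2 ≠ 0 then 1 / 2 else 1 / 3

/-- The point `j/n = (j₁/n, j₂/n, j₃/n)`. -/
def pt (n : ℕ) (j : ℤ × ℤ × ℤ) : ℝ × ℝ × ℝ :=
  ((j.1 : ℝ) / n, (j.2.1 : ℝ) / n, (j.2.2 : ℝ) / n)

/-- Homogeneous coordinates `t(x) = (-x₂/2 + √3 x₁/2, x₂, -x₂/2 - √3 x₁/2)`. -/
def Tmap (x : ℝ × ℝ) : ℝ × ℝ × ℝ :=
  (-x.2 / 2 + Real.sqrt 3 * x.1 / 2, x.2, -x.2 / 2 - Real.sqrt 3 * x.1 / 2)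

/-- The planar hexagon `Ω_H` (of area 2√3). -/
def OmegaH : Set (ℝ × ℝ) :=
  {x | -1 ≤ (Tmap x).1 ∧ (Tmap x).1 < 1 ∧ -1 ≤ (Tmap x).2.1 ∧ (Tmap x).2.1 < 1 ∧
       -1 ≤ -(Tmap x).2.2 ∧ -(Tmap x).2.2 < 1}

/-- `⟨f,g⟩_H = (1/(2√3)) ∫_{Ω_H} f(t(x)) conj(g(t(x))) dx`. -/
def innerH (f g : ℝ × ℝ × ℝ → ℂ) : ℂ :=
  ((1 / (2 * Real.sqrt 3) : ℝ) : ℂ) *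
    ∫ x in OmegaH, f (Tmap x) * (starRingEnd ℂ) (g (Tmap x))

/-- `Θ_m(t)`, the quotient of products of sines. -/
def Theta (m : ℕ) (t : ℝ × ℝ × ℝ) : ℝ :=
  (Real.sin ((m + 1) * Real.pi * (t.1 - t.2.1) / 3) *
   Real.sin ((m + 1) * Real.pi * (t.2.1 - t.2.2) / 3) *
   Real.sin ((m + 1) * Real.pi * (t.2.2 - t.1) / 3)) /
  (Real.sin (Real.pi * (t.1 - t.2.1) / 3) *
   Real.sin (Real.pi * (t.2.1 - t.2.2) / 3) *
   Real.sin (Real.pi * (t.2.2 - t.1) / 3))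

/-- `exp (2iθ) - 1 = 2i exp (iθ) sin θ`. -/
lemma exp_two_mul_I_sub_one (θ : ℂ) :
    Complex.exp (2 * θ * Complex.I) - 1 =
      2 * Complex.I * (Complex.exp (θ * Complex.I) * Complex.sin θ) := by
  have h2 : Complex.exp (2 * θ * Complex.I) =
      Complex.exp (θ * Complex.I) * Complex.exp (θ * Complex.I) := by
    rw [← Complex.exp_add]; ring_nf
  have h0 : Complex.exp (θ * Complex.I) * Complex.exp (-θ * Complex.I) = 1 := by
    rw [← Complex.exp_add]; simp
  rw [Complex.sin, h2]
  linear_combination (Complex.exp (θ * Complex.I) * Complex.exp (θ * Complex.I) -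
    Complex.exp (θ * Complex.I) * Complex.exp (-θ * Complex.I)) * Complex.I_sq + h0

/-- The geometric sum of `exp (2iθ)` in terms of sines. -/
lemma geom_sum_exp_mul_sin (θ : ℂ) (N : ℕ) :
    (∑ k ∈ Finset.range N, Complex.exp (2 * θ * Complex.I) ^ k) *
        (Complex.exp (θ * Complex.I) * Complex.sin θ) =
      Complex.exp (N * θ * Complex.I) * Complex.sin (N * θ) := by
  have h := geom_sum_mul (Complex.exp (2 * θ * Complex.I)) N
  have hN : Complex.exp (2 * θ * Complex.I) ^ N = Complex.exp (2 * (N * θ) * Complex.I) := by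
    rw [← Complex.exp_nat_mul]; ring_nf
  rw [hN, exp_two_mul_I_sub_one, exp_two_mul_I_sub_one] at h
  have hI : (2 * Complex.I : ℂ) ≠ 0 := by simp
  apply mul_left_cancel₀ hI
  linear_combination h

/-- For angles summing to zero, the product of three geometric sums is a quotient of sines. -/
lemma geom_sum_exp_prod_eq_sin_quotient (α β γ : ℂ) (h : α + β + γ = 0)
    (hα : Complex.sin α ≠ 0) (hβ : Complex.sin β ≠ 0) (hγ : Complex.sin γ ≠ 0) (N : ℕ) :
    (∑ k ∈ Finset.range N, Complex.exp (2 * α * Complex.I) ^ k) *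
      (∑ k ∈ Finset.range N, Complex.exp (2 * β * Complex.I) ^ k) *
      (∑ k ∈ Finset.range N, Complex.exp (2 * γ * Complex.I) ^ k) =
    (Complex.sin (N * α) * Complex.sin (N * β) * Complex.sin (N * γ)) /
      (Complex.sin α * Complex.sin β * Complex.sin γ) := by
  have e1 : Complex.exp (α * Complex.I) * Complex.exp (β * Complex.I) *
      Complex.exp (γ * Complex.I) = 1 := by
    rw [← Complex.exp_add, ← Complex.exp_add, ← add_mul, ← add_mul, h]; simp
  have eN : Complex.exp (N * α * Complex.I) * Complex.exp (N * β * Complex.I) *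
      Complex.exp (N * γ * Complex.I) = 1 := by
    rw [← Complex.exp_add, ← Complex.exp_add, ← add_mul, ← add_mul, ← mul_add, ← mul_add, h]
    simp
  rw [eq_div_iff (by simp [hα, hβ, hγ])]
  have hprod := congrArg₂ (· * ·) (congrArg₂ (· * ·) (geom_sum_exp_mul_sin α N)
    (geom_sum_exp_mul_sin β N)) (geom_sum_exp_mul_sin γ N)
  generalize (∑ k ∈ Finset.range N, Complex.exp (2 * α * Complex.I) ^ k) = A at *
  generalize (∑ k ∈ Finset.range N, Complex.exp (2 * β * Complex.I) ^ k) = B at *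
  generalize (∑ k ∈ Finset.range N, Complex.exp (2 * γ * Complex.I) ^ k) = C at *
  linear_combination hprod -
    A * B * C * Complex.sin α * Complex.sin β * Complex.sin γ * e1 +
    Complex.sin (N * α) * Complex.sin (N * β) * Complex.sin (N * γ) * eN

/-- The cube `{0, …, N - 1}³`. -/
def cube (N : ℕ) : Finset (ℕ × ℕ × ℕ) :=
  Finset.range N ×ˢ Finset.range N ×ˢ Finset.range N

lemma mem_cube {N : ℕ} {v : ℕ × ℕ × ℕ} : v ∈ cube N ↔ v.1 < N ∧ v.2.1 < N ∧ v.2.2 < N := by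
  simp [cube]

/-- The cyclic differences of a triple of naturals. -/
def cyclicDiff (v : ℕ × ℕ × ℕ) : ℤ × ℤ × ℤ :=
  ((v.1 : ℤ) - v.2.2, (v.2.1 : ℤ) - v.1, (v.2.2 : ℤ) - v.2.1)

/-- Each point of `ℍ_n*` is the cyclic difference of a unique triple with maximum `n`. -/
lemma bijOn_cyclicDiff (n : ℕ) :
    Set.BijOn cyclicDiff (↑(cube (n + 1) \ cube n) : Set (ℕ × ℕ × ℕ)) (Hstar n) := by
  refine ⟨?_, ?_, ?_⟩
  · rintro ⟨k, l, p⟩ h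
    simp only [Finset.coe_sdiff, Set.mem_sdiff, Finset.mem_coe, mem_cube] at h
    simp only [Hstar, cyclicDiff, Set.mem_ofPred_eq]
    omega
  · rintro ⟨k, l, p⟩ h ⟨k', l', p'⟩ h' he
    simp only [Finset.coe_sdiff, Set.mem_sdiff, Finset.mem_coe, mem_cube] at h h'
    simp only [cyclicDiff, Prod.mk.injEq] at he ⊢
    omega
  · rintro ⟨a, b, c⟩ h
    simp only [Hstar, Set.mem_ofPred_eq] at h
    have key : ∃ k l p : ℕ, (k < n + 1 ∧ l < n + 1 ∧ p < n + 1) ∧ ¬(k < n ∧ l < n ∧ p < n) ∧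
        (k : ℤ) - p = a ∧ (l : ℤ) - k = b ∧ (p : ℤ) - l = c := by
      by_cases hk : 0 ≤ a ∧ b ≤ 0
      · exact ⟨n, (n + b).toNat, (n - a).toNat, by omega⟩
      · by_cases hl : 0 ≤ b ∧ c ≤ 0
        · exact ⟨(n - b).toNat, n, (n + c).toNat, by omega⟩
        · exact ⟨(n + a).toNat, (n - c).toNat, n, by omega⟩
    obtain ⟨k, l, p, h1, h2, h3, h4, h5⟩ := key
    refine ⟨(k, l, p), ?_, by simp [cyclicDiff, h3, h4, h5]⟩
    simp only [Finset.coe_sdiff, Set.mem_sdiff, Finset.mem_coe, mem_cube]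
    exact ⟨h1, h2⟩

lemma phi_cyclicDiff (v : ℕ × ℕ × ℕ) (t : ℝ × ℝ × ℝ) :
    phi (cyclicDiff v) t =
      Complex.exp (2 * ((Real.pi * (t.1 - t.2.1) / 3 : ℝ) : ℂ) * Complex.I) ^ v.1 *
      Complex.exp (2 * ((Real.pi * (t.2.1 - t.2.2) / 3 : ℝ) : ℂ) * Complex.I) ^ v.2.1 *
      Complex.exp (2 * ((Real.pi * (t.2.2 - t.1) / 3 : ℝ) : ℂ) * Complex.I) ^ v.2.2 := by
  simp only [phi, cyclicDiff, ← Complex.exp_nat_mul, ← Complex.exp_add]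
  congr 1
  push_cast
  ring

/-- `Θ_m` is the sum of `φ` over the cyclic differences of the cube `{0, …, m}³`. -/
lemma sum_cube_phi_cyclicDiff (m : ℕ) (t : ℝ × ℝ × ℝ)
    (h1 : Real.sin (Real.pi * (t.1 - t.2.1) / 3) ≠ 0)
    (h2 : Real.sin (Real.pi * (t.2.1 - t.2.2) / 3) ≠ 0)
    (h3 : Real.sin (Real.pi * (t.2.2 - t.1) / 3) ≠ 0) :
    ∑ v ∈ cube (m + 1), phi (cyclicDiff v) t = ((Theta m t : ℝ) : ℂ) := by
  have h := geom_sum_exp_prod_eq_sin_quotient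
    ((Real.pi * (t.1 - t.2.1) / 3 : ℝ) : ℂ) ((Real.pi * (t.2.1 - t.2.2) / 3 : ℝ) : ℂ)
    ((Real.pi * (t.2.2 - t.1) / 3 : ℝ) : ℂ) (by push_cast; ring)
    (by rw [← Complex.ofReal_sin]; exact_mod_cast h1)
    (by rw [← Complex.ofReal_sin]; exact_mod_cast h2)
    (by rw [← Complex.ofReal_sin]; exact_mod_cast h3) (m + 1)
  have e (x : ℝ) : ((m : ℝ) + 1) * Real.pi * x / 3 = ((m + 1 : ℕ) : ℝ) * (Real.pi * x / 3) := by
    push_cast; ring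
  simp only [phi_cyclicDiff, cube, Finset.sum_product, Theta, e]
  simp only [mul_assoc, ← Finset.mul_sum, ← Finset.sum_mul] at h ⊢
  rw [h]
  push_cast
  rfl

theorem stmt_8 (n : ℕ) (hn : 1 ≤ n) (t : ℝ × ℝ × ℝ)
    (ht : t.1 + t.2.1 + t.2.2 = 0)
    (h1 : Real.sin (Real.pi * (t.1 - t.2.1) / 3) ≠ 0)
    (h2 : Real.sin (Real.pi * (t.2.1 - t.2.2) / 3) ≠ 0)
    (h3 : Real.sin (Real.pi * (t.2.2 - t.1) / 3) ≠ 0) :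
    (∑ᶠ j ∈ Hstar n, phi j t) = ((Theta n t - Theta (n - 1) t : ℝ) : ℂ) := by
  obtain ⟨m, rfl⟩ : ∃ m, n = m + 1 := ⟨n - 1, by omega⟩
  have hsub : cube (m + 1) ⊆ cube (m + 1 + 1) := fun v hv => by
    rw [mem_cube] at hv ⊢
    omega
  rw [← finsum_mem_eq_of_bijOn cyclicDiff (bijOn_cyclicDiff (m + 1)) (fun _ _ => rfl),
    finsum_mem_coe_finset, Finset.sum_sdiff_eq_sub hsub,
    sum_cube_phi_cyclicDiff (m + 1) t h1 h2 h3, sum_cube_phi_cyclicDiff m t h1 h2 h3,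
    Nat.add_sub_cancel, Complex.ofReal_sub]
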